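/- If A is a commutative normed algebra possessing a bounded sequential approximate identity, then there exists an algebra norm p on A equivalent to the original norm such that (A, p) is stable: for every a ∈ A and M > 0, the condition p(a·b) ≤ M·p(b) for all b ∈ A implies p(a) ≤ M. -/

import Mathlib

open Filter Topology

namespace StableNorm

section basic
variable {A : Type*} [NonUnitalNormedCommRing A]

/-- `pw f k` is `f ^ (k+1)`. -/
def pw (f : A) : ℕ → A
  | 0 => f
  | k + 1 => f * pw f k

/-- `Phi h r k` is `(h + r)^k - r^k`. -/
def Phi (h : A) (r : ℕ) : ℕ → A
  | 0 => 0
  | k + 1 => h * Phi h r k + r • Phi h r k + r ^ k • h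

lemma Phi_zero_succ (h : A) (k : ℕ) : Phi h 0 (k + 1) = pw h k := by
  induction k with
  | zero => simp [Phi, pw]
  | succ k ih => rw [Phi, ih]; simp [pw]

lemma pw_add (f : A) (k l : ℕ) : pw f (k + l + 1) = pw f k * pw f l := by
  induction k with
  | zero => simp [pw]
  | succ k ih =>
    rw [show k + 1 + l + 1 = (k + l + 1) + 1 by ring, pw, ih, pw, mul_assoc]

lemma norm_Phi_le (c : ℕ) (x : A) (hx : ‖x‖ ≤ c) (r k : ℕ) :
    ‖Phi x r k‖ ≤ ((r : ℝ) + c) ^ k - (r : ℝ) ^ k := by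
  induction k with
  | zero => simp [Phi]
  | succ k ih =>
    have h1 : ‖x * Phi x r k‖ ≤ c * (((r : ℝ) + c) ^ k - (r : ℝ) ^ k) :=
      (norm_mul_le _ _).trans (mul_le_mul hx ih (norm_nonneg _) (by positivity))
    have h2 : ‖r • Phi x r k‖ ≤ r * (((r : ℝ) + c) ^ k - (r : ℝ) ^ k) :=
      (norm_nsmul_le).trans (by gcongr)
    have h3 : ‖r ^ k • x‖ ≤ (r : ℝ) ^ k * c := by
      refine (norm_nsmul_le).trans ?_
      push_cast
      gcongr
    calc ‖Phi x r (k + 1)‖ ≤ ‖x * Phi x r k‖ + ‖r • Phi x r k‖ + ‖r ^ k • x‖ := norm_add₃_le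
      _ ≤ c * (((r : ℝ) + c) ^ k - (r : ℝ) ^ k) + r * (((r : ℝ) + c) ^ k - (r : ℝ) ^ k)
          + (r : ℝ) ^ k * c := by gcongr
      _ = _ := by ring

lemma tendsto_e_mul (e : ℕ → A) (c : ℕ) (hc : ∀ n, ‖e n‖ ≤ c)
    (hai : ∀ x : A, Tendsto (fun n => e n * x) atTop (𝓝 x)) {y : ℕ → A} {l : A} (hy : Tendsto y atTop (𝓝 l)) :
    Tendsto (fun n => e n * y n) atTop (𝓝 l) := by
  have h1 : Tendsto (fun n => e n * (y n - l)) atTop (𝓝 0) := by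
    refine squeeze_zero_norm (a := fun n => (c : ℝ) * ‖y n - l‖) (fun n => ?_) ?_
    · exact (norm_mul_le _ _).trans (by gcongr; exact hc n)
    · have : Tendsto (fun n => ‖y n - l‖) atTop (𝓝 0) := by
        rw [← tendsto_iff_norm_sub_tendsto_zero]; exact hy
      simpa using this.const_mul (c : ℝ)
  have h2 := h1.add (hai l)
  simpa [mul_sub] using h2

lemma tendsto_nsmul (r : ℕ) {y : ℕ → A} {l : A} (hy : Tendsto y atTop (𝓝 l)) :
    Tendsto (fun n => r • y n) atTop (𝓝 (r • l)) :=
  ((continuous_nsmul r).tendsto l).comp hy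

lemma tendsto_Phi_mul (e : ℕ → A) (c : ℕ) (hc : ∀ n, ‖e n‖ ≤ c)
    (hai : ∀ x : A, Tendsto (fun n => e n * x) atTop (𝓝 x)) (x : A) (r k : ℕ) :
    Tendsto (fun n => Phi (e n) r k * x + r ^ k • x) atTop (𝓝 ((r + 1) ^ k • x)) := by
  induction k with
  | zero => simp [Phi]
  | succ k ih =>
    have h := (tendsto_e_mul e c hc hai ih).add (tendsto_nsmul r ih)
    refine (h.congr fun n => ?_).trans_eq ?_
    · simp only [Phi, add_mul, mul_add, smul_add, pow_succ', mul_nsmul', mul_smul, smul_mul_assoc,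
        mul_smul_comm, mul_assoc]
      abel
    · congr 1
      rw [pow_succ' (r+1), add_mul, add_smul, one_mul, mul_smul, add_comm]

lemma tendsto_Phi_add (e : ℕ → A) (c : ℕ) (hc : ∀ n, ‖e n‖ ≤ c)
    (hai : ∀ x : A, Tendsto (fun n => e n * x) atTop (𝓝 x)) (h : A) (r k : ℕ) :
    Tendsto (fun n => Phi (h + e n) r k - Phi (e n) r k) atTop (𝓝 (Phi h (r + 1) k)) := by
  induction k with
  | zero => simp [Phi]
  | succ k ih =>
    have h1 := ((tendsto_e_mul e c hc hai ih).add (tendsto_nsmul r ih)).add (ih.const_mul h)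
    have h2 := h1.add (tendsto_Phi_mul e c hc hai h r k)
    refine (h2.congr fun n => ?_).trans_eq ?_
    · simp only [Phi, add_mul, mul_sub, smul_sub, smul_add, mul_comm (Phi (e n) r k) h]
      abel
    · congr 1
      simp only [Phi, add_smul, one_smul]
      abel

lemma eventually_compact (e : ℕ → A) (c : ℕ) (hc : ∀ n, ‖e n‖ ≤ c)
    (hai : ∀ x : A, Tendsto (fun n => e n * x) atTop (𝓝 x)) {T : Set A} (hT : IsCompact T) {η : ℝ} (hη : 0 < η) :
    ∀ᶠ n in atTop, ∀ x ∈ T, ‖e n * x - x‖ ≤ η := by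
  have hd : 0 < η / (2 * (c + 1)) := by positivity
  obtain ⟨t, -, htf, hcov⟩ := hT.finite_cover_balls hd
  have h1 : ∀ᶠ n in atTop, ∀ y ∈ t, ‖e n * y - y‖ < η / 2 := by
    rw [htf.eventually_all]
    intro y _
    have := (tendsto_iff_norm_sub_tendsto_zero.1 (hai y))
    exact this.eventually_lt_const (by positivity)
  filter_upwards [h1] with n hn x hx
  obtain ⟨y, hy, hxy⟩ := Set.mem_iUnion₂.1 (hcov hx)
  rw [mem_ball_iff_norm] at hxy
  have e1 : e n * x - x = (e n * y - y) + (e n * (x - y) - (x - y)) := by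
    rw [mul_sub]; abel
  have e2 : ‖e n * (x - y)‖ ≤ c * ‖x - y‖ :=
    (norm_mul_le _ _).trans (by gcongr; exact hc n)
  have e3 : (c + 1 : ℝ) * ‖x - y‖ ≤ η / 2 := by
    calc (c + 1 : ℝ) * ‖x - y‖ ≤ (c + 1) * (η / (2 * (c + 1))) := by gcongr
      _ = η / 2 := by field_simp
  rw [e1]
  have := norm_add_le (e n * y - y) (e n * (x - y) - (x - y))
  have := norm_sub_le (e n * (x - y)) (x - y)
  have := hn y hy
  linarith

lemma exists_H (e : ℕ → A) (c : ℕ) (hc : ∀ n, ‖e n‖ ≤ c)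
    (hai : ∀ x : A, Tendsto (fun n => e n * x) atTop (𝓝 x)) (k0 N : ℕ) {T : Set A} (hT : IsCompact T) (i : ℕ) :
    ∀ (r : ℕ) (η : ℝ), 0 < η → ∃ H : A,
      (∀ k ≤ k0, ‖Phi H r k‖ ≤
        ∑ j ∈ Finset.range i, (((r + j + c : ℕ) : ℝ) ^ k - ((r + j : ℕ) : ℝ) ^ k) + η) ∧
      (∀ x ∈ T, ‖H * x - i • x‖ ≤ η) ∧
      (∀ (x : A) (η' : ℝ), (∀ j ≥ N, ‖e j * x - x‖ ≤ η') → ‖H * x - i • x‖ ≤ i * η') := by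
  induction i with
  | zero =>
    intro r η hη
    refine ⟨0, fun k _ => ?_, fun x _ => by simpa using hη.le, fun x η' _ => by simp⟩
    have : Phi (0 : A) r k = 0 := by
      induction k with
      | zero => rfl
      | succ k ih => simp_all [Phi, Nat.le_of_succ_le]
    simpa [this] using hη.le
  | succ i ih =>
    intro r η hη
    obtain ⟨H, h1, h2, h3⟩ := ih (r + 1) (η / 2) (by positivity)
    have a1 : ∀ᶠ n in atTop, ∀ k ∈ Set.Iic k0,
        ‖(Phi (H + e n) r k - Phi (e n) r k) - Phi H (r + 1) k‖ < η / 2 := by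
      rw [(Set.finite_Iic k0).eventually_all]
      intro k _
      exact (tendsto_iff_norm_sub_tendsto_zero.1
        (tendsto_Phi_add e c hc hai H r k)).eventually_lt_const (by positivity)
    have a2 := eventually_compact e c hc hai hT (half_pos hη)
    obtain ⟨n, b1, b2, b3⟩ := (a1.and (a2.and (eventually_ge_atTop N))).exists
    have key : ∀ x : A, ‖(H + e n) * x - (i + 1) • x‖ ≤ ‖H * x - i • x‖ + ‖e n * x - x‖ := by
      intro x
      refine le_of_eq_of_le (congrArg _ ?_) (norm_add_le _ _)
      rw [add_mul, add_smul, one_smul]; abel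
    refine ⟨H + e n, fun k hk => ?_, fun x hx => ?_, fun x η' hx => ?_⟩
    · have c1 := b1 k hk
      have c2 := h1 k hk
      have c3 := norm_Phi_le c (e n) (hc n) r k
      have c4 : ‖Phi (H + e n) r k‖ ≤
          ‖(Phi (H + e n) r k - Phi (e n) r k) - Phi H (r + 1) k‖ + ‖Phi (e n) r k‖
            + ‖Phi H (r + 1) k‖ := by
        refine le_of_eq_of_le (congrArg _ ?_) norm_add₃_le
        abel
      rw [Finset.sum_range_succ']
      have c5 : ∑ j ∈ Finset.range i, (((r + 1 + j + c : ℕ) : ℝ) ^ k - ((r + 1 + j : ℕ) : ℝ) ^ k)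
          = ∑ j ∈ Finset.range i,
            (((r + (j + 1) + c : ℕ) : ℝ) ^ k - ((r + (j + 1) : ℕ) : ℝ) ^ k) := by
        refine Finset.sum_congr rfl fun j _ => ?_
        rw [show r + 1 + j = r + (j + 1) by ring]
      rw [c5] at c2
      push_cast at *
      simp only [add_zero] at *
      linarith
    · linarith [key x, h2 x hx, b2 x hx]
    · have := h3 x η' hx
      have := hx n b3
      push_cast
      linarith [key x]

lemma telescoping (n c k : ℕ) :
    ∑ j ∈ Finset.range n, (((0 + j + c : ℕ) : ℝ) ^ k - ((0 + j : ℕ) : ℝ) ^ k)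
      ≤ c * ((n + c - 1 : ℕ) : ℝ) ^ k := by
  have h1 : ∑ j ∈ Finset.range n, (((0 + j + c : ℕ) : ℝ) ^ k - ((0 + j : ℕ) : ℝ) ^ k)
      = ∑ j ∈ Finset.range c, ((n + j : ℕ) : ℝ) ^ k - ∑ j ∈ Finset.range c, (j : ℝ) ^ k := by
    have e1 := Finset.sum_range_add (fun j : ℕ => (j : ℝ) ^ k) n c
    have e2 := Finset.sum_range_add (fun j : ℕ => (j : ℝ) ^ k) c n
    rw [add_comm c n] at e2
    rw [Finset.sum_sub_distrib]
    simp only [zero_add]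
    have e3 : ∑ j ∈ Finset.range n, ((j + c : ℕ) : ℝ) ^ k
      = ∑ j ∈ Finset.range n, ((c + j : ℕ) : ℝ) ^ k :=
      Finset.sum_congr rfl fun j _ => by rw [add_comm]
    linarith
  rw [h1]
  have h2 : 0 ≤ ∑ j ∈ Finset.range c, (j : ℝ) ^ k := Finset.sum_nonneg fun _ _ => by positivity
  have h3 : ∑ j ∈ Finset.range c, ((n + j : ℕ) : ℝ) ^ k
      ≤ ∑ j ∈ Finset.range c, ((n + c - 1 : ℕ) : ℝ) ^ k := by
    refine Finset.sum_le_sum fun j hj => ?_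
    have := Finset.mem_range.1 hj
    gcongr
    omega
  rw [Finset.sum_const, Finset.card_range, nsmul_eq_mul] at h3
  linarith

end basic

section complex
variable {A : Type*} [NonUnitalNormedCommRing A] [NormedSpace ℂ A]
    [IsScalarTower ℂ A A] [SMulCommClass ℂ A A]

lemma pw_smul (d : ℂ) (H : A) (k : ℕ) : pw (d • H) k = d ^ (k + 1) • pw H k := by
  induction k with
  | zero => simp [pw]
  | succ k ih => rw [pw, ih, pw, smul_mul_smul_comm, ← pow_succ']

lemma pw_bounds (f : A) (k0 : ℕ) (K : ℝ) (h1 : ∀ k ≤ k0, ‖pw f k‖ ≤ K)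
    (h2 : ‖pw f k0‖ ≤ 1 / 2) :
    (∀ k, ‖pw f k‖ ≤ K) ∧ Tendsto (fun k => pw f k) atTop (𝓝 0) := by
  have hK : 0 ≤ K := (norm_nonneg _).trans (h1 0 (Nat.zero_le _))
  have main : ∀ m k, k ≤ k0 → ‖pw f (m * (k0 + 1) + k)‖ ≤ (1 / 2 : ℝ) ^ m * K := by
    intro m
    induction m with
    | zero => intro k hk; simpa using h1 k hk
    | succ m ih =>
      intro k hk
      rw [show (m + 1) * (k0 + 1) + k = k0 + (m * (k0 + 1) + k) + 1 by ring, pw_add]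
      calc _ ≤ ‖pw f k0‖ * ‖pw f (m * (k0 + 1) + k)‖ := norm_mul_le _ _
        _ ≤ (1 / 2) * ((1 / 2) ^ m * K) := by gcongr; exact ih k hk
        _ = _ := by ring
  have main2 : ∀ k, ‖pw f k‖ ≤ (1 / 2 : ℝ) ^ (k / (k0 + 1)) * K := by
    intro k
    have := main (k / (k0 + 1)) (k % (k0 + 1)) (Nat.lt_succ_iff.1 (Nat.mod_lt _ (Nat.succ_pos _)))
    rwa [mul_comm, Nat.div_add_mod] at this
  constructor
  · intro k
    refine (main2 k).trans ?_
    exact mul_le_of_le_one_left hK (pow_le_one₀ (by norm_num) (by norm_num))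
  · refine squeeze_zero_norm main2 ?_
    have t1 : Tendsto (fun k => k / (k0 + 1)) atTop atTop :=
      Nat.tendsto_div_const_atTop (Nat.succ_ne_zero _)
    have t2 := (tendsto_pow_atTop_nhds_zero_of_lt_one (r := (1 / 2 : ℝ))
      (by norm_num) (by norm_num)).comp t1
    simpa using t2.mul_const K

lemma pw_mul_bound (f x : A) (K t η : ℝ) (ht0 : 0 ≤ t) (ht : t < 1)
    (hK : ∀ k, ‖pw f k‖ ≤ K) (hx : ‖f * x - (t : ℂ) • x‖ ≤ η) (hK1 : 1 ≤ K) (k : ℕ) :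
    ‖pw f k * x - ((t : ℂ) ^ (k + 1)) • x‖ ≤ K * η / (1 - t) := by
  have h1t : 0 < 1 - t := by linarith
  have hη : 0 ≤ η := (norm_nonneg _).trans hx
  induction k with
  | zero =>
    simp only [pw, zero_add, pow_one]
    refine hx.trans ?_
    rw [le_div_iff₀ h1t]
    nlinarith
  | succ k ih =>
    have e1 : pw f (k + 1) * x - ((t : ℂ) ^ (k + 1 + 1)) • x
        = pw f k * (f * x - (t : ℂ) • x) + (t : ℂ) • (pw f k * x - ((t : ℂ) ^ (k + 1)) • x) := by
      rw [mul_sub, smul_sub, smul_smul, ← pow_succ', mul_smul_comm, pw, mul_comm f, mul_assoc]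
      abel
    rw [e1]
    refine (norm_add_le _ _).trans ?_
    have e2 : ‖pw f k * (f * x - (t : ℂ) • x)‖ ≤ K * η :=
      (norm_mul_le _ _).trans (mul_le_mul (hK k) hx (norm_nonneg _) (by linarith))
    have e3 : ‖(t : ℂ) • (pw f k * x - ((t : ℂ) ^ (k + 1)) • x)‖ ≤ t * (K * η / (1 - t)) := by
      rw [norm_smul, Complex.norm_real, Real.norm_of_nonneg ht0]
      gcongr
    have e4 : K * η + t * (K * η / (1 - t)) = K * η / (1 - t) := by field_simp; ring
    linarith

lemma exists_f (e : ℕ → A) (c : ℕ) (hc1 : 1 ≤ c) (hc : ∀ n, ‖e n‖ ≤ c)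
    (hai : ∀ x : A, Tendsto (fun n => e n * x) atTop (𝓝 x))
    (N : ℕ) {T : Set A} (hT : IsCompact T) {ε : ℝ} (hε : 0 < ε) :
    ∃ f : A, (∀ k, ‖pw f k‖ ≤ c + 1) ∧ Tendsto (fun k => pw f k) atTop (𝓝 0) ∧
      (∀ k, ∀ x ∈ T, ‖pw f k * x‖ ≤ ‖x‖ + ε) ∧
      (∀ (x : A) (η : ℝ), (∀ j ≥ N, ‖e j * x - x‖ ≤ η) →
        ‖f * x - x‖ ≤ η + ‖x‖ / (N + 1)) := by
  have hcR : (1 : ℝ) ≤ c := by exact_mod_cast hc1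
  set n : ℕ := c * (N + 1) with hn
  set D : ℝ := (n : ℝ) + c with hD
  have hn0 : (0 : ℝ) ≤ n := by positivity
  have hD1 : 1 ≤ D := by linarith
  have hD0 : 0 < D := by linarith
  have hcast : ((n + c - 1 : ℕ) : ℝ) = D - 1 := by
    rw [Nat.cast_sub (by omega)]; push_cast; ring
  set ρ : ℝ := (D - 1) / D with hρ
  have hρ0 : 0 ≤ ρ := div_nonneg (by linarith) hD0.le
  have hρ1 : ρ < 1 := by rw [hρ, div_lt_one hD0]; linarith
  set t : ℝ := n / D with ht
  have ht0 : 0 ≤ t := by positivity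
  have ht1 : t < 1 := by rw [ht, div_lt_one hD0]; linarith
  obtain ⟨k0, hk0⟩ := exists_pow_lt_of_lt_one (show (0 : ℝ) < 1 / (4 * c) by positivity) hρ1
  have hk0' : c * ρ ^ (k0 + 1) ≤ 1 / 4 := by
    have : ρ ^ (k0 + 1) ≤ 1 / (4 * c) := by
      rw [pow_succ]
      nlinarith [pow_nonneg hρ0 k0]
    calc c * ρ ^ (k0 + 1) ≤ c * (1 / (4 * c)) := by gcongr
      _ = 1 / 4 := by field_simp
  set η : ℝ := min (1 / 4) (ε * (1 - t) / (c + 1)) with hη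
  have hηp : 0 < η := lt_min (by norm_num) (by
    have : 0 < 1 - t := by linarith
    positivity)
  obtain ⟨H, h1, h2, h3⟩ := exists_H e c hc hai (k0 + 1) N hT n 0 η hηp
  set d : ℝ := 1 / D with hd
  have hd0 : 0 ≤ d := by positivity
  have hd1 : d ≤ 1 := by rw [hd, div_le_one hD0]; exact hD1
  have hdn : ‖(d : ℂ)‖ = d := by rw [Complex.norm_real, Real.norm_of_nonneg hd0]
  set f : A := (d : ℂ) • H with hf
  have hpw : ∀ k ≤ k0, ‖pw f k‖ ≤ c * ρ ^ (k + 1) + 1 / 4 := by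
    intro k hk
    rw [hf, pw_smul, norm_smul, norm_pow, hdn, ← Phi_zero_succ]
    have a1 := h1 (k + 1) (by omega)
    have a2 := telescoping n c (k + 1)
    rw [hcast] at a2
    have a3 : η ≤ 1 / 4 := min_le_left _ _
    have a4 : d ^ (k + 1) ≤ 1 := pow_le_one₀ hd0 hd1
    calc d ^ (k + 1) * ‖Phi H 0 (k + 1)‖ ≤ d ^ (k + 1) * (c * (D - 1) ^ (k + 1) + 1 / 4) := by
          gcongr; linarith
      _ = c * (d * (D - 1)) ^ (k + 1) + d ^ (k + 1) * (1 / 4) := by rw [mul_pow]; ring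
      _ ≤ c * ρ ^ (k + 1) + 1 / 4 := by
          rw [show d * (D - 1) = ρ by rw [hd, hρ]; ring]
          linarith
  obtain ⟨b1, b2⟩ := pw_bounds f k0 (c + 1) (fun k hk => (hpw k hk).trans (by
      have : ρ ^ (k + 1) ≤ 1 := pow_le_one₀ hρ0 hρ1.le
      nlinarith)) ((hpw k0 le_rfl).trans (by linarith))
  have hfx : ∀ x : A, ‖f * x - (t : ℂ) • x‖ = d * ‖H * x - n • x‖ := by
    intro x
    rw [← hdn, ← norm_smul, smul_sub, hf, smul_mul_assoc, ← Nat.cast_smul_eq_nsmul ℂ n x,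
      smul_smul]
    congr 3
    rw [ht, hd]; push_cast; ring
  refine ⟨f, b1, b2, fun k x hx => ?_, fun x η' hx => ?_⟩
  · have hx1 : ‖f * x - (t : ℂ) • x‖ ≤ η := by
      rw [hfx]
      have := h2 x hx
      nlinarith [norm_nonneg (H * x - n • x)]
    have g1 := pw_mul_bound f x (c + 1) t η ht0 ht1 b1 hx1 (by linarith) k
    have g2 : ((c : ℝ) + 1) * η / (1 - t) ≤ ε := by
      rw [div_le_iff₀ (by linarith)]
      calc ((c : ℝ) + 1) * η ≤ (c + 1) * (ε * (1 - t) / (c + 1)) := by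
            gcongr; exact min_le_right _ _
        _ = ε * (1 - t) := by field_simp
    have g3 : ‖((t : ℂ) ^ (k + 1)) • x‖ ≤ ‖x‖ := by
      rw [norm_smul, norm_pow, Complex.norm_real, Real.norm_of_nonneg ht0]
      exact mul_le_of_le_one_left (norm_nonneg _) (pow_le_one₀ ht0 ht1.le)
    have g4 := norm_sub_norm_le (pw f k * x) (((t : ℂ) ^ (k + 1)) • x)
    linarith
  · have g1 := h3 x η' hx
    have hη' : 0 ≤ η' := (norm_nonneg _).trans (hx N le_rfl)
    have g2 : ‖f * x - (t : ℂ) • x‖ ≤ η' := by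
      rw [hfx]
      calc d * ‖H * x - n • x‖ ≤ d * (n * η') := by gcongr
        _ = t * η' := by rw [ht, hd]; ring
        _ ≤ η' := mul_le_of_le_one_left hη' ht1.le
    have g3 : ‖(t : ℂ) • x - x‖ ≤ ‖x‖ / (N + 1) := by
      have : (t : ℂ) • x - x = ((t - 1 : ℝ) : ℂ) • x := by
        push_cast; rw [sub_smul, one_smul]
      rw [this, norm_smul, Complex.norm_real, Real.norm_eq_abs, abs_sub_comm,
        abs_of_nonneg (by linarith)]
      have h1t : 1 - t ≤ 1 / (N + 1) := by
        have hnn : (n : ℝ) = c * (N + 1) := by rw [hn]; push_cast; ring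
        rw [ht, one_sub_div hD0.ne', div_le_div_iff₀ hD0 (by positivity), hD, hnn]
        nlinarith
      calc (1 - t) * ‖x‖ ≤ 1 / (N + 1) * ‖x‖ := by gcongr
        _ = _ := by ring
    have := norm_sub_le_norm_sub_add_norm_sub (f * x) ((t : ℂ) • x) x
    linarith

/-- Invariant of the recursive construction. -/
def Good (c : ℕ) (T : Set A) : Prop :=
  IsCompact T ∧ (∀ x ∈ T, ∀ y ∈ T, x * y ∈ T) ∧ ∃ b : ℝ, b < c + 2 ∧ ∀ x ∈ T, ‖x‖ ≤ b

lemma step (e : ℕ → A) (c : ℕ) (hc1 : 1 ≤ c) (hc : ∀ n, ‖e n‖ ≤ c)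
    (hai : ∀ x : A, Tendsto (fun n => e n * x) atTop (𝓝 x))
    (N : ℕ) (T : {T : Set A // Good c T}) :
    ∃ T' : {T : Set A // Good c T}, T.1 ⊆ T'.1 ∧ ∃ f ∈ T'.1,
      (∀ (x : A) (η : ℝ), (∀ j ≥ N, ‖e j * x - x‖ ≤ η) →
        ‖f * x - x‖ ≤ η + ‖x‖ / (N + 1)) := by
  obtain ⟨T, hT, hmul, b, hb, hTb⟩ := T
  obtain ⟨f, f1, f2, f3, f4⟩ := exists_f e c hc1 hc hai N hT (show 0 < (c + 2 - b) / 2 by linarith)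
  set P : Set A := insert 0 (Set.range (pw f)) with hP
  have hPc : IsCompact P := f2.isCompact_insert_range
  have hPP : ∀ x ∈ P, ∀ y ∈ P, x * y ∈ P := by
    rintro x (rfl | ⟨k, rfl⟩) y (rfl | ⟨l, rfl⟩)
    · simp [hP]
    · simp [hP]
    · simp [hP]
    · rw [← pw_add]; exact Or.inr ⟨_, rfl⟩
  have hQc : IsCompact ((fun q : A × A => q.1 * q.2) '' (P ×ˢ T)) :=
    (hPc.prod hT).image continuous_mul
  set Q := (fun q : A × A => q.1 * q.2) '' (P ×ˢ T) with hQ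
  have mQ : ∀ x ∈ P, ∀ y ∈ T, x * y ∈ Q := fun x hx y hy => ⟨(x, y), ⟨hx, hy⟩, rfl⟩
  refine ⟨⟨P ∪ T ∪ Q, (hPc.union hT).union hQc, ?_, max (c + 1) (b + (c + 2 - b) / 2), ?_, ?_⟩,
    ?_, f, ?_, f4⟩
  · rintro x ((hx | hx) | ⟨⟨x, x'⟩, ⟨hx, hx'⟩, rfl⟩) y ((hy | hy) | ⟨⟨y, y'⟩, ⟨hy, hy'⟩, rfl⟩)
    · exact Or.inl (Or.inl (hPP x hx y hy))
    · exact Or.inr (mQ x hx y hy)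
    · refine Or.inr ?_
      simp only [← mul_assoc]
      exact mQ _ (hPP x hx y hy) _ hy'
    · refine Or.inr ?_
      rw [mul_comm]; exact mQ y hy x hx
    · exact Or.inl (Or.inr (hmul x hx y hy))
    · refine Or.inr ?_
      simp only
      rw [mul_left_comm]
      exact mQ _ hy _ (hmul x hx y' hy')
    · refine Or.inr ?_
      simp only
      rw [mul_right_comm]
      exact mQ _ (hPP x hx y hy) _ hx'
    · refine Or.inr ?_
      simp only
      rw [mul_assoc]
      exact mQ _ hx _ (hmul x' hx' y hy)
    · refine Or.inr ?_
      simp only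
      rw [mul_mul_mul_comm]
      exact mQ _ (hPP x hx y hy) _ (hmul x' hx' y' hy')
  · refine max_lt ?_ ?_ <;> linarith
  · rintro x ((hx | hx) | ⟨⟨x, x'⟩, ⟨hx, hx'⟩, rfl⟩)
    · refine le_max_of_le_left ?_
      rcases hx with rfl | ⟨k, rfl⟩
      · simp; positivity
      · exact f1 k
    · refine le_max_of_le_right ?_
      linarith [hTb x hx]
    · refine le_max_of_le_right ?_
      have hx'' := hTb x' hx'
      simp only at hx hx'
      rcases hx with rfl | ⟨k, rfl⟩
      · simp only [zero_mul, norm_zero]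
        linarith [norm_nonneg x']
      · linarith [f3 k x' hx']
  · exact fun x hx => Or.inl (Or.inr hx)
  · exact Or.inl (Or.inl (Or.inr ⟨0, rfl⟩))

lemma exists_semigroup (e : ℕ → A) (c : ℕ) (hc1 : 1 ≤ c) (hc : ∀ n, ‖e n‖ ≤ c)
    (hai : ∀ x : A, Tendsto (fun n => e n * x) atTop (𝓝 x)) :
    ∃ (S : Set A) (f : ℕ → A), (∀ x ∈ S, ∀ y ∈ S, x * y ∈ S) ∧ (∀ x ∈ S, ‖x‖ ≤ c + 2) ∧
      (∀ n, f n ∈ S) ∧ ∀ x : A, Tendsto (fun n => f n * x) atTop (𝓝 x) := by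
  choose F hF1 g hg1 hg2 using step e c hc1 hc hai
  have h0 : Good c ({0} : Set A) := ⟨isCompact_singleton, by simp, 0, by positivity, by simp⟩
  let T : ℕ → {T : Set A // Good c T} := fun n => Nat.rec ⟨{0}, h0⟩ F n
  have hTs : ∀ n, T (n + 1) = F n (T n) := fun n => rfl
  have hmono : Monotone (fun n => (T n).1) :=
    monotone_nat_of_le_succ fun n => by rw [hTs]; exact hF1 n (T n)
  refine ⟨⋃ n, (T n).1, fun n => g n (T n), ?_, ?_, ?_, ?_⟩
  · intro x hx y hy
    obtain ⟨i, hi⟩ := Set.mem_iUnion.1 hx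
    obtain ⟨j, hj⟩ := Set.mem_iUnion.1 hy
    exact Set.mem_iUnion.2 ⟨max i j, (T (max i j)).2.2.1 x (hmono (le_max_left i j) hi) y
      (hmono (le_max_right i j) hj)⟩
  · intro x hx
    obtain ⟨i, hi⟩ := Set.mem_iUnion.1 hx
    obtain ⟨b, hb, hb'⟩ := (T i).2.2.2
    exact (hb' x hi).trans hb.le
  · intro n
    exact Set.mem_iUnion.2 ⟨n + 1, hg1 n (T n)⟩
  · intro x
    rw [Metric.tendsto_atTop]
    intro ε hε
    obtain ⟨N1, hN1⟩ := Metric.tendsto_atTop.1 (hai x) (ε / 2) (by positivity)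
    have t1 : Tendsto (fun n : ℕ => ‖x‖ / ((n : ℝ) + 1)) atTop (𝓝 0) := by
      simpa [div_eq_mul_inv] using
        (tendsto_one_div_add_atTop_nhds_zero_nat (𝕜 := ℝ)).const_mul ‖x‖
    obtain ⟨N2, hN2⟩ := eventually_atTop.1 (t1.eventually_lt_const (half_pos hε))
    refine ⟨max N1 N2, fun n hn => ?_⟩
    have a1 := hg2 n (T n) x (ε / 2) (fun j hj => by
      have := hN1 j (by omega)
      rw [dist_eq_norm] at this
      exact this.le)
    have a2 := hN2 n (by omega)
    rw [dist_eq_norm]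
    linarith

lemma norm_of_semigroup (S : Set A) (f : ℕ → A) (K : ℝ) (hK : 0 < K)
    (hmul : ∀ x ∈ S, ∀ y ∈ S, x * y ∈ S) (hSK : ∀ x ∈ S, ‖x‖ ≤ K)
    (hfS : ∀ n, f n ∈ S) (hf : ∀ x : A, Tendsto (fun n => f n * x) atTop (𝓝 x)) :
    ∃ p : A → ℝ,
      (∀ x : A, 0 ≤ p x) ∧
      (∀ x : A, p x = 0 ↔ x = 0) ∧
      (∀ x y : A, p (x + y) ≤ p x + p y) ∧
      (∀ (c : ℂ) (x : A), p (c • x) = ‖c‖ * p x) ∧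
      (∀ x y : A, p (x * y) ≤ p x * p y) ∧
      (∃ c C' : ℝ, 0 < c ∧ 0 < C' ∧ ∀ x : A, c * ‖x‖ ≤ p x ∧ p x ≤ C' * ‖x‖) ∧
      (∀ (a : A) (M : ℝ), 0 < M →
        ((∀ b : A, p (a * b) ≤ M * p b) → p a ≤ M) ∧
        ((∀ b : A, p (b * a) ≤ M * p b) → p a ≤ M)) := by
  haveI : Nonempty S := ⟨⟨f 0, hfS 0⟩⟩
  obtain ⟨p0, hp0⟩ : ∃ p0 : A → ℝ, p0 = fun a => ⨆ s : S, ‖s.1 * a‖ := ⟨_, rfl⟩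
  have hbd : ∀ a (s : S), ‖s.1 * a‖ ≤ K * ‖a‖ := fun a s =>
    (norm_mul_le _ _).trans (by gcongr; exact hSK _ s.2)
  have hle : ∀ a, ∀ s ∈ S, ‖s * a‖ ≤ p0 a := fun a s hs => by
    rw [hp0]
    exact le_ciSup (f := fun s : S => ‖s.1 * a‖) ⟨K * ‖a‖, by rintro _ ⟨s, rfl⟩; exact hbd a s⟩
      ⟨s, hs⟩
  have hsup : ∀ a B, (∀ s ∈ S, ‖s * a‖ ≤ B) → p0 a ≤ B := fun a B h => by
    rw [hp0]
    exact ciSup_le fun s => h s.1 s.2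
  have p0K : ∀ a, p0 a ≤ K * ‖a‖ := fun a => hsup a _ fun s hs => hbd a ⟨s, hs⟩
  have p0n : ∀ a, ‖a‖ ≤ p0 a := fun a =>
    le_of_tendsto (hf a).norm (Eventually.of_forall fun n => hle a _ (hfS n))
  have p00 : ∀ a, 0 ≤ p0 a := fun a => (norm_nonneg a).trans (p0n a)
  have p0add : ∀ a b, p0 (a + b) ≤ p0 a + p0 b := fun a b => hsup _ _ fun s hs => by
    rw [mul_add]
    exact (norm_add_le _ _).trans (add_le_add (hle a s hs) (hle b s hs))
  have p0smul : ∀ (c : ℂ) a, p0 (c • a) ≤ ‖c‖ * p0 a := fun c a => hsup _ _ fun s hs => by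
    rw [mul_smul_comm, norm_smul]
    gcongr
    exact hle a s hs
  have p0S : ∀ s ∈ S, ∀ a, p0 (s * a) ≤ p0 a := fun s hs a => hsup _ _ fun u hu => by
    rw [← mul_assoc]
    exact hle a _ (hmul u hu s hs)
  obtain ⟨p, hp⟩ : ∃ p : A → ℝ, p = fun a => sInf {M : ℝ | 0 ≤ M ∧ ∀ b, p0 (a * b) ≤ M * p0 b} :=
    ⟨_, rfl⟩
  have hbb : ∀ a, BddBelow {M : ℝ | 0 ≤ M ∧ ∀ b, p0 (a * b) ≤ M * p0 b} := fun a =>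
    ⟨0, fun M hM => hM.1⟩
  have ple : ∀ a M, 0 ≤ M → (∀ b, p0 (a * b) ≤ M * p0 b) → p a ≤ M := fun a M h1 h2 => by
    rw [hp]; exact csInf_le (hbb a) ⟨h1, h2⟩
  have hmemK : ∀ a, K * ‖a‖ ∈ {M : ℝ | 0 ≤ M ∧ ∀ b, p0 (a * b) ≤ M * p0 b} := fun a =>
    ⟨by positivity, fun b => by
      calc p0 (a * b) ≤ K * ‖a * b‖ := p0K _
        _ ≤ K * (‖a‖ * ‖b‖) := by gcongr; exact norm_mul_le _ _
        _ ≤ K * (‖a‖ * p0 b) := by gcongr; exact p0n b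
        _ = _ := by ring⟩
  have hmem : ∀ a, p a ∈ {M : ℝ | 0 ≤ M ∧ ∀ b, p0 (a * b) ≤ M * p0 b} := fun a => by
    rw [hp]
    refine IsClosed.csInf_mem ?_ ⟨_, hmemK a⟩ (hbb a)
    simp only [Set.setOf_and, Set.setOf_forall]
    refine (isClosed_le continuous_const continuous_id).inter (isClosed_iInter fun b => ?_)
    exact isClosed_le continuous_const (continuous_id.mul continuous_const)
  have pnn : ∀ a, 0 ≤ p a := fun a => (hmem a).1
  have pop : ∀ a b, p0 (a * b) ≤ p a * p0 b := fun a => (hmem a).2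
  have pK : ∀ a, p a ≤ K * ‖a‖ := fun a => ple a _ (hmemK a).1 (hmemK a).2
  have pS : ∀ s ∈ S, p s ≤ 1 := fun s hs => ple s 1 zero_le_one fun b => by
    rw [one_mul]; exact p0S s hs b
  have plow : ∀ a, ‖a‖ ≤ p a * (K * K) := fun a =>
    le_of_tendsto (hf a).norm (Eventually.of_forall fun n => by
      calc ‖f n * a‖ ≤ p0 (f n * a) := p0n _
        _ = p0 (a * f n) := by rw [mul_comm]
        _ ≤ p a * p0 (f n) := pop _ _
        _ ≤ p a * (K * ‖f n‖) := mul_le_mul_of_nonneg_left (p0K _) (pnn a)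
        _ ≤ p a * (K * K) := mul_le_mul_of_nonneg_left
            (mul_le_mul_of_nonneg_left (hSK _ (hfS n)) hK.le) (pnn a))
  have padd : ∀ x y, p (x + y) ≤ p x + p y := fun x y =>
    ple _ _ (add_nonneg (pnn x) (pnn y)) fun b => by
      rw [add_mul, add_mul]
      exact (p0add _ _).trans (add_le_add (pop _ _) (pop _ _))
  have psm : ∀ (c : ℂ) x, p (c • x) ≤ ‖c‖ * p x := fun c x =>
    ple _ _ (mul_nonneg (norm_nonneg _) (pnn x)) fun b => by
      rw [smul_mul_assoc, mul_assoc]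
      exact (p0smul _ _).trans (mul_le_mul_of_nonneg_left (pop _ _) (norm_nonneg _))
  have p0' : p 0 = 0 := le_antisymm (by simpa using pK 0) (pnn 0)
  have stab : ∀ (a : A) (M : ℝ), 0 < M → (∀ b : A, p (a * b) ≤ M * p b) → p a ≤ M := by
    intro a M hM h
    have t : Tendsto (fun n => M + K * ‖f n * a - a‖) atTop (𝓝 (M + K * 0)) :=
      ((tendsto_iff_norm_sub_tendsto_zero.1 (hf a)).const_mul K).const_add M
    rw [mul_zero, add_zero] at t
    refine ge_of_tendsto t (Eventually.of_forall fun n => ?_)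
    have h1 : p (a * f n) ≤ M := (h (f n)).trans (by
      have := pS _ (hfS n)
      nlinarith)
    have h2 := padd (a * f n) (a - a * f n)
    rw [add_sub_cancel] at h2
    have h3 := pK (a - a * f n)
    rw [norm_sub_rev, mul_comm a] at h3
    rw [mul_comm a] at h1 h2
    linarith
  refine ⟨p, pnn, fun x => ⟨fun h => ?_, fun h => h ▸ p0'⟩, padd, fun c x => ?_, fun x y => ?_,
    ⟨(K * K)⁻¹, K, by positivity, hK, fun x => ⟨?_, pK x⟩⟩, fun a M hM => ⟨stab a M hM, fun h => ?_⟩⟩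
  · have := plow x
    rw [h, zero_mul] at this
    exact norm_le_zero_iff.1 this
  · refine le_antisymm (psm c x) ?_
    rcases eq_or_ne c 0 with rfl | hc
    · simp [p0']
    · have h1 := psm c⁻¹ (c • x)
      rw [inv_smul_smul₀ hc, norm_inv] at h1
      have hc' : 0 < ‖c‖ := norm_pos_iff.2 hc
      rwa [inv_mul_eq_div, le_div_iff₀ hc', mul_comm] at h1
  · refine ple _ _ (mul_nonneg (pnn x) (pnn y)) fun b => ?_
    rw [mul_assoc, mul_assoc]
    exact (pop _ _).trans (mul_le_mul_of_nonneg_left (pop _ _) (pnn x))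
  · rw [inv_mul_le_iff₀ (by positivity), mul_comm]
    exact plow x
  · exact stab a M hM fun b => by rw [mul_comm]; exact h b

end complex

end StableNorm

/-- If `A` is a commutative normed algebra (over `ℂ`) possessing a bounded sequential
approximate identity, then there is an algebra norm `p` on `A`, equivalent to the
original norm, such that `(A, p)` is stable. -/
theorem exists_equiv_stable_norm_of_bounded_seq_approx_identity
    {A : Type*} [NonUnitalNormedCommRing A] [NormedSpace ℂ A]
    [IsScalarTower ℂ A A] [SMulCommClass ℂ A A]
    (e : ℕ → A) (C : ℝ) (hC : ∀ n, ‖e n‖ ≤ C)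
    (hai : ∀ x : A, Tendsto (fun n => e n * x) atTop (𝓝 x)) :
    ∃ p : A → ℝ,
      (∀ x : A, 0 ≤ p x) ∧
      (∀ x : A, p x = 0 ↔ x = 0) ∧
      (∀ x y : A, p (x + y) ≤ p x + p y) ∧
      (∀ (c : ℂ) (x : A), p (c • x) = ‖c‖ * p x) ∧
      (∀ x y : A, p (x * y) ≤ p x * p y) ∧
      (∃ c C' : ℝ, 0 < c ∧ 0 < C' ∧ ∀ x : A, c * ‖x‖ ≤ p x ∧ p x ≤ C' * ‖x‖) ∧
      (∀ (a : A) (M : ℝ), 0 < M →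
        ((∀ b : A, p (a * b) ≤ M * p b) → p a ≤ M) ∧
        ((∀ b : A, p (b * a) ≤ M * p b) → p a ≤ M)) := by
  obtain ⟨c0, hc0⟩ := exists_nat_ge C
  have hc : ∀ n, ‖e n‖ ≤ ((c0 + 1 : ℕ) : ℝ) := fun n => by
    push_cast
    linarith [hC n]
  obtain ⟨S, f, h1, h2, h3, h4⟩ :=
    StableNorm.exists_semigroup e (c0 + 1) (by omega) hc hai
  exact StableNorm.norm_of_semigroup S f _ (by positivity) h1 h2 h3 h4
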